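/- For n ≥ 1, h(D_{2^n} × C_2) satisfies the recurrence (for n > 3): h(D_{2^n} × C_2) = 2·h(Z/2 × Z/2^{n-1}) + 8·h(D_{2^n}) − 16·h(D_{2^{n-1}}) − 4·h(Z/2 × Z/2^{n-2}) + 4·h(D_{2^{n-1}} × C_2). -/

import Mathlib

/-- The number of nonempty chains of subgroups of `G` (under strict inclusion,
i.e. finite sets of subgroups that are totally ordered) whose largest element is `G` itself. -/
noncomputable def numChains (G : Type*) [Group G] : ℕ :=
  Nat.card {C : Finset (Subgroup G) //
    IsChain (· ≤ ·) (C : Set (Subgroup G)) ∧ (⊤ : Subgroup G) ∈ C}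

open scoped Classical in
theorem numChains_eq_card_filter_top_mem (G : Type*) [Group G] [Finite G] [Fintype (Subgroup G)] :
    numChains G = (Finset.univ.filter fun C : Finset (Subgroup G) =>
      IsChain (· ≤ ·) (C : Set (Subgroup G)) ∧ ⊤ ∈ C).card := by
  rw [numChains, Nat.card_eq_fintype_card, Fintype.card_subtype]

open scoped Classical in
theorem numChains_eq_card_filter_top_notMem (G : Type*) [Group G] [Finite G]
    [Fintype (Subgroup G)] :
    numChains G = (Finset.univ.filter fun C : Finset (Subgroup G) =>
      IsChain (· ≤ ·) (C : Set (Subgroup G)) ∧ ⊤ ∉ C).card := by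
  rw [numChains_eq_card_filter_top_mem]
  refine Finset.card_bij' (fun C _ => C.erase ⊤) (fun C _ => insert ⊤ C) ?_ ?_ ?_ ?_
  · simp only [Finset.mem_filter, Finset.mem_univ, true_and]
    exact fun C hC => ⟨hC.1.mono (by simp), by simp⟩
  · simp only [Finset.mem_filter, Finset.mem_univ, true_and]
    refine fun C hC => ⟨?_, by simp⟩
    rw [Finset.coe_insert]
    exact hC.1.insert fun H _ _ => Or.inr le_top
  · simp only [Finset.mem_filter, Finset.mem_univ, true_and]
    exact fun C hC => Finset.insert_erase hC.2
  · simp only [Finset.mem_filter, Finset.mem_univ, true_and]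
    exact fun C hC => Finset.erase_insert hC.2

theorem numChains_congr {G G' : Type*} [Group G] [Group G'] (e : G ≃* G') :
    numChains G = numChains G' := by
  refine Nat.card_congr (Equiv.subtypeEquiv (e.mapSubgroup.toEquiv.finsetCongr) fun C => ?_)
  have htop : (⊤ : Subgroup G') = e.mapSubgroup ⊤ := (OrderIso.map_top _).symm
  refine and_congr ?_ ?_
  · simp only [Equiv.finsetCongr_apply, Finset.coe_map]
    refine ⟨fun h => e.mapSubgroup.monotone.isChain_image h, fun h => ?_⟩
    have h' := e.mapSubgroup.symm.monotone.isChain_image h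
    change IsChain _ (e.mapSubgroup.symm '' (e.mapSubgroup '' C)) at h'
    simpa only [Set.image_image, OrderIso.symm_apply_apply, Set.image_id'] using h'
  · rw [htop]
    simp

theorem numChains_eq_of_range_eq {G G' : Type*} [Group G] [Group G'] {f : G' →* G}
    (hf : Function.Injective f) {K : Subgroup G} (hK : f.range = K) :
    numChains K = numChains G' := by
  subst hK
  exact (numChains_congr (MonoidHom.ofInjective hf)).symm

theorem numChains_map {G G' : Type*} [Group G] [Group G'] {f : G' →* G}
    (hf : Function.Injective f) (K : Subgroup G') :
    numChains (K.map f) = numChains K :=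
  (numChains_congr (K.equivMapOfInjective f hf)).symm

open scoped Classical in
theorem two_mul_numChains (G : Type*) [Group G] [Finite G] [Fintype (Subgroup G)] :
    2 * numChains G = (Finset.univ.filter fun C : Finset (Subgroup G) =>
      IsChain (· ≤ ·) (C : Set (Subgroup G))).card := by
  rw [two_mul]
  nth_rewrite 1 [numChains_eq_card_filter_top_mem]
  rw [numChains_eq_card_filter_top_notMem, ← Finset.filter_filter, ← Finset.filter_filter,
    Finset.card_filter_add_card_filter_not]

open scoped Classical in
theorem two_mul_numChains_subgroup {G : Type*} [Group G] [Finite G] [Fintype (Subgroup G)]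
    (K : Subgroup G) :
    2 * numChains K = (Finset.univ.filter fun C : Finset (Subgroup G) =>
      IsChain (· ≤ ·) (C : Set (Subgroup G)) ∧ ∀ H ∈ C, H ≤ K).card := by
  have : Fintype (Subgroup K) := Fintype.ofFinite _
  rw [two_mul_numChains]
  have hinj : Function.Injective (Subgroup.map K.subtype) :=
    Subgroup.map_injective K.subtype_injective
  refine Finset.card_bij (fun C _ => C.map ⟨_, hinj⟩) ?_ ?_ ?_
  · simp only [Finset.mem_filter, Finset.mem_univ, true_and]
    refine fun C hC => ⟨?_, ?_⟩
    · rw [Finset.coe_map]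
      exact Monotone.isChain_image (fun _ _ h => Subgroup.map_mono h) hC
    · simp only [Finset.mem_map, Function.Embedding.coeFn_mk]
      rintro _ ⟨H, -, rfl⟩
      exact Subgroup.map_subtype_le H
  · exact fun _ _ _ _ h => Finset.map_injective _ h
  · simp only [Finset.mem_filter, Finset.mem_univ, true_and]
    refine fun C hC => ⟨C.image (·.subgroupOf K), ?_, ?_⟩
    · rw [Finset.coe_image]
      exact Monotone.isChain_image (fun _ _ h => Subgroup.comap_mono h) hC.1
    · rw [Finset.map_eq_image, Finset.image_image]
      refine (Finset.image_congr fun H hH => ?_).trans Finset.image_id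
      exact Subgroup.map_subgroupOf_eq_of_le (hC.2 H hH)

theorem IsChain.exists_isGreatest_of_finset {α : Type*} [PartialOrder α] {C : Finset α}
    (hC : IsChain (· ≤ ·) (C : Set α)) (hne : C.Nonempty) : ∃ m ∈ C, ∀ x ∈ C, x ≤ m := by
  obtain ⟨m, hm⟩ := C.exists_maximal hne
  refine ⟨m, hm.prop, fun x hx => ?_⟩
  exact (hC.total hx hm.prop).elim id fun h => hm.le_of_ge hx h

open scoped Classical in
/-- Möbius inversion principle for `numChains`. -/
theorem numChains_eq_sum_of_indicator {G ι : Type*} [Group G] [Finite G] [Nontrivial G]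
    [Fintype ι] (w : ι → ℤ) (K : ι → Subgroup G)
    (hK : ∀ H : Subgroup G, ∑ i, w i * (if H ≤ K i then 1 else 0) = if H = ⊤ then 0 else 1) :
    (numChains G : ℤ) = ∑ i, w i * (2 * numChains (K i)) := by
  have : Fintype (Subgroup G) := Fintype.ofFinite _
  have key (C : Finset (Subgroup G)) (hC : IsChain (· ≤ ·) (C : Set (Subgroup G))) :
      ∑ i, w i * (if ∀ H ∈ C, H ≤ K i then 1 else 0) = if ⊤ ∉ C then (1 : ℤ) else 0 := by
    rcases C.eq_empty_or_nonempty with rfl | hne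
    · simpa [bot_ne_top] using hK ⊥
    · obtain ⟨m, hm, hmax⟩ := hC.exists_isGreatest_of_finset hne
      have h1 (i : ι) : (∀ H ∈ C, H ≤ K i) ↔ m ≤ K i :=
        ⟨fun h => h m hm, fun h H hH => (hmax H hH).trans h⟩
      have h2 : ⊤ ∈ C ↔ m = ⊤ :=
        ⟨fun h => top_le_iff.mp (hmax ⊤ h), fun h => h ▸ hm⟩
      simp only [h1, h2, hK, ite_not]
  have h2 (i : ι) : (2 * numChains (K i) : ℤ) =
      ∑ C ∈ Finset.univ.filter fun C : Finset (Subgroup G) =>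
          IsChain (· ≤ ·) (C : Set (Subgroup G)),
        if ∀ H ∈ C, H ≤ K i then 1 else 0 := by
    rw [Finset.sum_boole, Finset.filter_filter]
    exact_mod_cast two_mul_numChains_subgroup (K i)
  simp only [h2, Finset.mul_sum]
  rw [Finset.sum_comm, numChains_eq_card_filter_top_notMem, ← Finset.filter_filter,
    ← Finset.sum_boole]
  exact Finset.sum_congr rfl fun C hC => (key C (Finset.mem_filter.mp hC).2).symm

theorem exists_le_ker_of_ne_top {G : Type*} [Group G] [Finite G] (hG : IsPGroup 2 G)
    {H : Subgroup G} (hH : H ≠ ⊤) :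
    ∃ χ : G →* Multiplicative (ZMod 2), χ ≠ 1 ∧ H ≤ χ.ker := by
  obtain ⟨N, hN⟩ := IsPGroup.iff_card.mp hG
  obtain ⟨j, hj⟩ := IsPGroup.iff_card.mp (hG.to_subgroup H)
  have hjN : j < N := by
    have : Nat.card H < Nat.card G := by
      refine lt_of_le_of_ne (Subgroup.card_le_card_group H) fun h => hH ?_
      exact Subgroup.card_eq_iff_eq_top H |>.mp h
    rw [hN, hj] at this
    exact (Nat.pow_lt_pow_iff_right (by norm_num)).mp this
  have : Fact (Nat.Prime 2) := ⟨Nat.prime_two⟩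
  obtain ⟨M, hM, hHM⟩ := Sylow.exists_subgroup_card_pow_prime_le (p := 2) (n := j) (m := N - 1)
    (by rw [hN]; exact pow_dvd_pow _ (by omega)) H hj (by omega)
  have hidx : M.index = 2 := by
    have h := M.card_mul_index
    obtain ⟨N, rfl⟩ : ∃ N', N = N' + 1 := ⟨N - 1, by omega⟩
    rw [hN, hM, Nat.add_sub_cancel, pow_succ] at h
    exact Nat.eq_of_mul_eq_mul_left (by positivity) h
  have : M.Normal := Subgroup.normal_of_index_eq_two hidx
  have e : G ⧸ M ≃* Multiplicative (ZMod 2) :=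
    mulEquivOfPrimeCardEq (p := 2) (by rw [← Subgroup.index, hidx]) (by simp)
  have hker : (e.toMonoidHom.comp (QuotientGroup.mk' M)).ker = M := by
    rw [MonoidHom.ker_comp_of_injective _ _ e.injective, QuotientGroup.ker_mk']
  refine ⟨e.toMonoidHom.comp (QuotientGroup.mk' M), fun h => ?_, hker.symm ▸ hHM⟩
  rw [h, MonoidHom.ker_one] at hker
  simp [← hker] at hidx

theorem mul_self_eq_one_of_zmod_two {G : Type*} [Group G] (χ : G →* Multiplicative (ZMod 2)) :
    χ * χ = 1 := by
  ext g
  exact CharTwo.add_self_eq_zero (R := ZMod 2) _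

theorem numChains_eq_two_mul_of_forall_hom {G : Type*} [Group G] [Finite G] (hG : IsPGroup 2 G)
    {a : G →* Multiplicative (ZMod 2)} (ha : a ≠ 1)
    (hgen : ∀ χ : G →* Multiplicative (ZMod 2), χ = 1 ∨ χ = a) :
    numChains G = 2 * numChains a.ker := by
  classical
  have : Nontrivial G := by
    by_contra h
    rw [not_nontrivial_iff_subsingleton] at h
    exact ha (MonoidHom.ext fun g => by simp [Subsingleton.elim g 1])
  have h := numChains_eq_sum_of_indicator (G := G) (ι := Unit) (fun _ => 1) (fun _ => a.ker) ?_
  · simp only [Finset.univ_unique, Finset.sum_const, Finset.card_singleton, one_mul, one_smul] at h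
    exact_mod_cast h
  · intro H
    by_cases hH : H = ⊤
    · subst hH
      simp [MonoidHom.ker_eq_top_iff, ha]
    · obtain ⟨χ, hχ, hle⟩ := exists_le_ker_of_ne_top hG hH
      rcases hgen χ with rfl | rfl
      · exact absurd rfl hχ
      · simp [hH, hle]

/-- The recurrence for a finite `2`-group with three generators. -/
theorem numChains_eq_of_rank_three {G : Type*} [Group G] [Finite G] (hG : IsPGroup 2 G)
    {a b c : G →* Multiplicative (ZMod 2)}
    (hne : a ≠ 1 ∧ b ≠ 1 ∧ a * b ≠ 1 ∧ c ≠ 1 ∧ a * c ≠ 1 ∧ b * c ≠ 1 ∧ a * b * c ≠ 1)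
    (hgen : ∀ χ : G →* Multiplicative (ZMod 2), χ = 1 ∨ χ = a ∨ χ = b ∨ χ = a * b ∨ χ = c ∨
      χ = a * c ∨ χ = b * c ∨ χ = a * b * c) :
    (numChains G : ℤ) =
      2 * (numChains a.ker + numChains b.ker + numChains (a * b).ker + numChains c.ker
        + numChains (a * c).ker + numChains (b * c).ker + numChains (a * b * c).ker)
      - 4 * (numChains ↥(a.ker ⊓ b.ker) + numChains ↥(c.ker ⊓ a.ker)
        + numChains ↥((b * c).ker ⊓ a.ker) + numChains ↥(c.ker ⊓ b.ker)
        + numChains ↥((a * c).ker ⊓ b.ker) + numChains ↥(c.ker ⊓ (a * b).ker)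
        + numChains ↥((a * c).ker ⊓ (a * b).ker))
      + 16 * numChains ↥(c.ker ⊓ (a.ker ⊓ b.ker)) := by
  classical
  obtain ⟨ha, hb, hab, hc, hac, hbc, habc⟩ := hne
  have : Nontrivial G := by
    by_contra h
    rw [not_nontrivial_iff_subsingleton] at h
    exact ha (MonoidHom.ext fun g => by simp [Subsingleton.elim g 1])
  have h := numChains_eq_sum_of_indicator (G := G) (ι := Fin 15)
    ![1, 1, 1, 1, 1, 1, 1, -2, -2, -2, -2, -2, -2, -2, 8]
    ![a.ker, b.ker, (a * b).ker, c.ker, (a * c).ker, (b * c).ker, (a * b * c).ker,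
      a.ker ⊓ b.ker, c.ker ⊓ a.ker, (b * c).ker ⊓ a.ker, c.ker ⊓ b.ker, (a * c).ker ⊓ b.ker,
      c.ker ⊓ (a * b).ker, (a * c).ker ⊓ (a * b).ker, c.ker ⊓ (a.ker ⊓ b.ker)] ?_
  · obtain ⟨f, hf⟩ : ∃ f : Subgroup G → ℤ, ∀ K : Subgroup G, (numChains K : ℤ) = f K :=
      ⟨_, fun _ => rfl⟩
    simp only [hf] at h ⊢
    simp only [Fin.sum_univ_succ, Matrix.cons_val_zero, Matrix.cons_val_succ, Fin.sum_univ_zero]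
      at h
    linarith
  · intro H
    simp only [Fin.sum_univ_succ, Matrix.cons_val_zero, Matrix.cons_val_succ, Fin.sum_univ_zero,
      le_inf_iff]
    by_cases hH : H = ⊤
    · subst hH
      simp [-MonoidHom.mul_apply, MonoidHom.ker_eq_top_iff, *]
    · have hmul {χ ψ ω : G →* Multiplicative (ZMod 2)} (h : χ * ψ = ω) (h1 : H ≤ χ.ker)
          (h2 : H ≤ ψ.ker) : H ≤ ω.ker := fun g hg => by
        rw [← h, MonoidHom.mem_ker, MonoidHom.mul_apply, MonoidHom.mem_ker.mp (h1 hg),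
          MonoidHom.mem_ker.mp (h2 hg), one_mul]
      have haa := mul_self_eq_one_of_zmod_two a
      have hbb := mul_self_eq_one_of_zmod_two b
      have hcc := mul_self_eq_one_of_zmod_two c
      have hex : H ≤ a.ker ∨ H ≤ b.ker ∨ H ≤ (a * b).ker ∨ H ≤ c.ker ∨ H ≤ (a * c).ker ∨
          H ≤ (b * c).ker ∨ H ≤ (a * b * c).ker := by
        obtain ⟨χ, hχ, hle⟩ := exists_le_ker_of_ne_top hG hH
        rcases hgen χ with h | h | h | h | h | h | h | h <;> subst h <;> simp_all
      have i1 := @hmul _ _ _ (rfl : a * b = a * b)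
      have i2 := @hmul _ _ _ (rfl : a * c = a * c)
      have i3 := @hmul _ _ _ (rfl : b * c = b * c)
      have i4 := @hmul _ _ _ (rfl : a * b * c = a * b * c)
      have j1 := hmul (show a * (a * b) = b by grind)
      have j2 := hmul (show b * (a * b) = a by grind)
      have j3 := hmul (show a * (a * c) = c by grind)
      have j4 := hmul (show c * (a * c) = a by grind)
      have j5 := hmul (show b * (b * c) = c by grind)
      have j6 := hmul (show c * (b * c) = b by grind)
      have j7 := hmul (show a * (b * c) = a * b * c by grind)
      have j8 := hmul (show a * (a * b * c) = b * c by grind)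
      have j9 := hmul (show (b * c) * (a * b * c) = a by grind)
      have j10 := hmul (show b * (a * c) = a * b * c by grind)
      have j11 := hmul (show b * (a * b * c) = a * c by grind)
      have j12 := hmul (show (a * c) * (a * b * c) = b by grind)
      have j13 := hmul (show c * (a * b * c) = a * b by grind)
      have j14 := hmul (show (a * b) * (a * b * c) = c by grind)
      have j15 := hmul (show (a * b) * (b * c) = a * c by grind)
      have j16 := hmul (show (a * b) * (a * c) = b * c by grind)
      have j17 := hmul (show (b * c) * (a * c) = a * b by grind)
      rw [if_neg hH]
      clear hmul haa hbb hcc ha hb hab hc hac hbc habc hgen hH hG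
      grind

theorem range_id_prod_inv {D : Type*} [Group D] (θ : D →* Multiplicative (ZMod 2)) :
    ((MonoidHom.id D).prod θ⁻¹).range =
      (θ.comp (MonoidHom.fst D (Multiplicative (ZMod 2))) * MonoidHom.snd D _).ker := by
  ext ⟨x, y⟩
  simp [MonoidHom.mem_ker, Prod.ext_iff, inv_eq_iff_mul_eq_one]

theorem map_id_prod_inv {D : Type*} [Group D] (θ : D →* Multiplicative (ZMod 2))
    (K : Subgroup D) :
    K.map ((MonoidHom.id D).prod θ⁻¹) =
      (θ.comp (MonoidHom.fst D (Multiplicative (ZMod 2))) * MonoidHom.snd D _).ker ⊓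
        K.comap (MonoidHom.fst D (Multiplicative (ZMod 2))) := by
  rw [← range_id_prod_inv]
  ext ⟨x, y⟩
  simp only [Subgroup.mem_map, Subgroup.mem_inf, MonoidHom.mem_range, Subgroup.mem_comap]
  constructor
  · rintro ⟨z, hz, h⟩
    obtain rfl : z = x := congrArg Prod.fst h
    exact ⟨⟨z, h⟩, hz⟩
  · rintro ⟨⟨z, h⟩, hx⟩
    obtain rfl : z = x := congrArg Prod.fst h
    exact ⟨z, hx, h⟩

theorem id_prod_inv_injective {D : Type*} [Group D] (θ : D →* Multiplicative (ZMod 2)) :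
    Function.Injective ((MonoidHom.id D).prod θ⁻¹) :=
  fun _ _ h => congrArg Prod.fst h

/-- The recurrence for `D × C₂`, where `D` is a finite `2`-group with two generators. -/
theorem numChains_prod_zmod_two {D : Type*} [Group D] [Finite D] (hD : IsPGroup 2 D)
    {a b : D →* Multiplicative (ZMod 2)} (hne : a ≠ 1 ∧ b ≠ 1 ∧ a * b ≠ 1)
    (hgen : ∀ χ : D →* Multiplicative (ZMod 2), χ = 1 ∨ χ = a ∨ χ = b ∨ χ = a * b) :
    (numChains (D × Multiplicative (ZMod 2)) : ℤ) =
      2 * (numChains (a.ker.comap (MonoidHom.fst D (Multiplicative (ZMod 2))))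
        + numChains (b.ker.comap (MonoidHom.fst D (Multiplicative (ZMod 2))))
        + numChains ((a * b).ker.comap (MonoidHom.fst D (Multiplicative (ZMod 2)))))
      + 8 * numChains D
      - 4 * numChains ((a.ker ⊓ b.ker).comap (MonoidHom.fst D (Multiplicative (ZMod 2))))
      - 8 * (numChains a.ker + numChains b.ker + numChains (a * b).ker)
      + 16 * numChains ↥(a.ker ⊓ b.ker) := by
  let C := Multiplicative (ZMod 2)
  let π := MonoidHom.fst D C
  let z := MonoidHom.snd D C
  have hP : IsPGroup 2 (D × C) := by
    obtain ⟨n, hn⟩ := IsPGroup.iff_card.mp hD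
    exact IsPGroup.of_card (n := n + 1) (by rw [Nat.card_prod, hn, pow_succ]; simp [C])
  have hC (ε : C →* C) : ε = 1 ∨ ε = MonoidHom.id C := by
    have h1 : ε (Multiplicative.ofAdd 0) = 1 := map_one ε
    have h2 : ∀ y : C, y = Multiplicative.ofAdd 0 ∨ y = Multiplicative.ofAdd 1 := by decide
    rcases h2 (ε (Multiplicative.ofAdd 1)) with h | h
    · left; ext y; rcases h2 y with rfl | rfl
      · exact h1
      · exact h
    · right; ext y; rcases h2 y with rfl | rfl
      · exact h1
      · exact h
  have hdecomp (χ : D × C →* C) : χ =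
      (χ.comp (MonoidHom.inl D C)).comp π * (χ.comp (MonoidHom.inr D C)).comp z := by
    ext ⟨x, y⟩
    simp [π, z, ← map_mul]
  have hz : z ≠ 1 := fun h => by
    have := DFunLike.congr_fun h (1, Multiplicative.ofAdd 1)
    revert this
    simp only [z, MonoidHom.coe_snd, MonoidHom.one_apply]
    decide
  have hπ {χ : D →* C} (hχ : χ ≠ 1) : χ.comp π ≠ 1 := fun h => hχ <| by
    ext x
    simpa [π] using DFunLike.congr_fun h (x, 1)
  have hπz (χ : D →* C) : χ.comp π * z ≠ 1 := fun h => by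
    have := DFunLike.congr_fun h (1, Multiplicative.ofAdd 1)
    revert this
    simp only [π, z, MonoidHom.mul_apply, MonoidHom.comp_apply, MonoidHom.coe_fst,
      MonoidHom.coe_snd, MonoidHom.one_apply, map_one, one_mul]
    decide
  have hrec := numChains_eq_of_rank_three hP (a := a.comp π) (b := b.comp π) (c := z)
    ⟨hπ hne.1, hπ hne.2.1, hπ hne.2.2, hz, hπz a, hπz b, hπz (a * b)⟩ (fun χ => by
      rw [hdecomp χ]
      rcases hgen (χ.comp (MonoidHom.inl D C)) with h | h | h | h <;>
      rcases hC (χ.comp (MonoidHom.inr D C)) with h' | h' <;>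
      rw [h, h'] <;>
      simp [MonoidHom.mul_comp])
  obtain ⟨f, hf⟩ : ∃ f : Subgroup (D × C) → ℤ, ∀ K : Subgroup (D × C), (numChains K : ℤ) = f K :=
    ⟨_, fun _ => rfl⟩
  have hg (θ : D →* C) : f (θ.comp π * z).ker = numChains D := by
    rw [← hf, numChains_eq_of_range_eq (id_prod_inv_injective θ) (range_id_prod_inv θ)]
  have hg' (θ : D →* C) (K : Subgroup D) :
      f ((θ.comp π * z).ker ⊓ K.comap π) = numChains K := by
    rw [← hf, ← map_id_prod_inv, numChains_map (id_prod_inv_injective θ)]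
  have h1 : z = (1 : D →* C).comp π * z := by simp
  have hk (χ : D →* C) : (χ.comp π).ker = χ.ker.comap π := (MonoidHom.comap_ker χ π).symm
  have hzD : f z.ker = numChains D := by rw [h1, hg]
  have hzK (K : Subgroup D) : f (z.ker ⊓ K.comap π) = numChains K := by
    rw [h1, hg']
  simp only [hf, ← MonoidHom.mul_comp, hg, hzD, hk, ← Subgroup.comap_inf, hg', hzK] at hrec
  simp only [← hf] at hrec
  rw [hrec]
  ring

section ParityAndDoubling

variable (k : ℕ)

/-- Reduction modulo `2` on `ZMod (2 * k)`. -/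
def parity : ZMod (2 * k) →+* ZMod 2 :=
  ZMod.castHom (Dvd.intro k rfl) (ZMod 2)

/-- Multiplication by two as an additive map `ZMod k → ZMod (2 * k)`. -/
def doubling : ZMod k →+ ZMod (2 * k) :=
  ZMod.lift k ⟨zmultiplesHom _ 2, by
    have h : ((2 * k : ℕ) : ZMod (2 * k)) = 0 := ZMod.natCast_self _
    push_cast at h
    simpa [mul_comm] using h⟩

variable {k}

theorem doubling_intCast (i : ℤ) : doubling k i = ((2 * i : ℤ) : ZMod (2 * k)) := by
  rw [doubling, ZMod.lift_coe]
  simp [mul_comm]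

theorem doubling_injective : Function.Injective (doubling k) := by
  rw [injective_iff_map_eq_zero]
  intro x hx
  obtain ⟨i, rfl⟩ := ZMod.intCast_surjective x
  rw [doubling_intCast, ZMod.intCast_zmod_eq_zero_iff_dvd] at hx
  rw [ZMod.intCast_zmod_eq_zero_iff_dvd]
  push_cast at hx
  exact (mul_dvd_mul_iff_left two_ne_zero).mp hx

theorem parity_eq_zero_iff {x : ZMod (2 * k)} : parity k x = 0 ↔ ∃ y, doubling k y = x := by
  constructor
  · obtain ⟨i, rfl⟩ := ZMod.intCast_surjective x
    rw [map_intCast, ZMod.intCast_zmod_eq_zero_iff_dvd]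
    rintro ⟨j, rfl⟩
    exact ⟨j, doubling_intCast j⟩
  · rintro ⟨y, rfl⟩
    obtain ⟨j, rfl⟩ := ZMod.intCast_surjective y
    rw [doubling_intCast, map_intCast, ZMod.intCast_zmod_eq_zero_iff_dvd]
    exact Dvd.intro j rfl

@[simp]
theorem parity_doubling (y : ZMod k) : parity k (doubling k y) = 0 :=
  parity_eq_zero_iff.mpr ⟨y, rfl⟩

end ParityAndDoubling

theorem numChains_multiplicative_zmod_two_mul {k n : ℕ} (hk : 2 * k = 2 ^ n) :
    numChains (Multiplicative (ZMod (2 * k))) = 2 * numChains (Multiplicative (ZMod k)) := by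
  have : NeZero (2 * k) := ⟨by rw [hk]; positivity⟩
  let a : Multiplicative (ZMod (2 * k)) →* Multiplicative (ZMod 2) :=
    (parity k).toAddMonoidHom.toMultiplicative
  have hG : IsPGroup 2 (Multiplicative (ZMod (2 * k))) := IsPGroup.of_card (n := n) (by simp [hk])
  rw [numChains_eq_two_mul_of_forall_hom hG (a := a)]
  · congr 1
    refine numChains_eq_of_range_eq (f := (doubling k).toMultiplicative) doubling_injective ?_
    ext x
    exact parity_eq_zero_iff.symm
  · intro h
    have := DFunLike.congr_fun h (Multiplicative.ofAdd 1)
    have h1 : parity k 1 = 0 := this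
    simp at h1
  · intro χ
    let χ' : ZMod (2 * k) →+ ZMod 2 := MonoidHom.toAdditive χ
    have key (i : ℤ) : χ' i = i * χ' 1 := by
      simpa using map_zsmul χ' i 1
    have h2 : ∀ y : ZMod 2, y = 0 ∨ y = 1 := by decide
    rcases h2 (χ' 1) with h | h
    · left
      refine MonoidHom.ext fun x => ?_
      obtain ⟨i, hi⟩ := ZMod.intCast_surjective x.toAdd
      have := key i
      rw [h, mul_zero, hi] at this
      exact this
    · right
      refine MonoidHom.ext fun x => ?_
      obtain ⟨i, hi⟩ := ZMod.intCast_surjective x.toAdd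
      have := key i
      rw [h, mul_one, ← map_intCast (parity k), hi] at this
      exact this

namespace DihedralGroup

variable {k : ℕ}

/-- The homomorphism to `C₂` sending `r 1` to `x` and `sr 0` to `y`. -/
def parityHom (k : ℕ) (x y : ZMod 2) : DihedralGroup (2 * k) →* Multiplicative (ZMod 2) :=
  MonoidHom.mk' (fun g => match g with
    | r i => Multiplicative.ofAdd (x * parity k i)
    | sr i => Multiplicative.ofAdd (x * parity k i + y)) <| by
  have h2 : ∀ y : ZMod 2, y + y = 0 := CharTwo.add_self_eq_zero
  rintro (i | i) (j | j) <;>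
    simp only [r_mul_r, r_mul_sr, sr_mul_r, sr_mul_sr, ← ofAdd_add, map_add, map_sub,
      CharTwo.sub_eq_add] <;>
    congr 1 <;> first | ring1 | linear_combination -h2 y

theorem parityHom_r (x y : ZMod 2) (i : ZMod (2 * k)) :
    parityHom k x y (r i) = Multiplicative.ofAdd (x * parity k i) := rfl

theorem parityHom_sr (x y : ZMod 2) (i : ZMod (2 * k)) :
    parityHom k x y (sr i) = Multiplicative.ofAdd (x * parity k i + y) := rfl

theorem parityHom_mul (x y x' y' : ZMod 2) :
    parityHom k x y * parityHom k x' y' = parityHom k (x + x') (y + y') := by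
  ext (i | i) <;>
  simp only [MonoidHom.mul_apply, parityHom_r, parityHom_sr, ← ofAdd_add] <;>
  congr 1 <;> ring_nf

theorem parityHom_ne_one {x y : ZMod 2} (h : x ≠ 0 ∨ y ≠ 0) : parityHom k x y ≠ 1 := by
  rintro heq
  have hr : x * parity k 1 = 0 := DFunLike.congr_fun heq (r 1)
  have hs : x * parity k 0 + y = 0 := DFunLike.congr_fun heq (sr 0)
  simp_all

theorem exists_eq_parityHom (χ : DihedralGroup (2 * k) →* Multiplicative (ZMod 2)) :
    ∃ x y, χ = parityHom k x y := by
  have hr (i : ZMod (2 * k)) :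
      χ (r i) = Multiplicative.ofAdd ((χ (r 1)).toAdd * parity k i) := by
    obtain ⟨i, rfl⟩ := ZMod.intCast_surjective i
    rw [← r_one_zpow, map_zpow, map_intCast, mul_comm (χ (r 1)).toAdd, ← zsmul_eq_mul,
      ofAdd_zsmul, ofAdd_toAdd]
  refine ⟨(χ (r 1)).toAdd, (χ (sr 0)).toAdd, MonoidHom.ext ?_⟩
  rintro (i | i)
  · exact hr i
  · rw [parityHom_sr, ofAdd_add, ← hr, ofAdd_toAdd, mul_comm (χ (r i)), ← map_mul,
      sr_mul_r, zero_add]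

/-- The embedding `D_k → D_{2k}` that doubles angles and shifts reflections by `c`. -/
def double (k : ℕ) (c : ZMod (2 * k)) : DihedralGroup k →* DihedralGroup (2 * k) :=
  MonoidHom.mk' (fun g => match g with
    | r i => r (doubling k i)
    | sr i => sr (doubling k i + c)) <| by
  rintro (i | i) (j | j) <;>
    simp only [r_mul_r, r_mul_sr, sr_mul_r, sr_mul_sr, map_add, map_sub] <;>
    congr 1 <;> abel_nf

theorem double_r (c : ZMod (2 * k)) (i : ZMod k) : double k c (r i) = r (doubling k i) := rfl

theorem double_sr (c : ZMod (2 * k)) (i : ZMod k) :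
    double k c (sr i) = sr (doubling k i + c) := rfl

theorem double_injective (c : ZMod (2 * k)) : Function.Injective (double k c) := by
  rintro (i | i) (j | j) h <;> simp only [double_r, double_sr, r.injEq, sr.injEq, reduceCtorEq] at h
  · rw [doubling_injective h]
  · rw [doubling_injective (add_right_cancel h)]

theorem range_double (c : ZMod (2 * k)) :
    (double k c).range = (parityHom k 1 (parity k c)).ker := by
  ext (i | i)
  · rw [MonoidHom.mem_ker, parityHom_r, one_mul, ofAdd_eq_one, parity_eq_zero_iff]
    constructor
    · rintro ⟨j | j, h⟩
      · exact ⟨j, r.inj h⟩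
      · cases h
    · rintro ⟨j, h⟩
      exact ⟨r j, congrArg r h⟩
  · rw [MonoidHom.mem_ker, parityHom_sr, one_mul, ofAdd_eq_one, ← CharTwo.sub_eq_add, ← map_sub,
      parity_eq_zero_iff]
    constructor
    · rintro ⟨j | j, h⟩
      · cases h
      · exact ⟨j, eq_sub_of_add_eq (sr.inj h)⟩
    · rintro ⟨j, h⟩
      exact ⟨sr j, congrArg sr (eq_sub_iff_add_eq.mp h)⟩

/-- The inclusion of the rotation subgroup. -/
def rotationHom (n : ℕ) : Multiplicative (ZMod n) →* DihedralGroup n :=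
  MonoidHom.mk' (fun i => r i.toAdd) fun _ _ => (r_mul_r _ _).symm

theorem rotationHom_injective (n : ℕ) : Function.Injective (rotationHom n) := fun _ _ h => r.inj h

theorem range_rotationHom : (rotationHom (2 * k)).range = (parityHom k 0 1).ker := by
  ext (i | i)
  · simp only [MonoidHom.mem_ker, parityHom_r, zero_mul, ofAdd_zero, iff_true]
    exact ⟨Multiplicative.ofAdd i, rfl⟩
  · simp only [MonoidHom.mem_ker, parityHom_sr, zero_mul, zero_add, ofAdd_eq_one, one_ne_zero,
      iff_false]
    rintro ⟨j, h⟩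
    cases h

theorem range_rotationHom_comp_doubling :
    ((rotationHom (2 * k)).comp (doubling k).toMultiplicative).range =
      (parityHom k 1 0).ker ⊓ (parityHom k 0 1).ker := by
  rw [← range_rotationHom]
  ext g
  constructor
  · rintro ⟨j, rfl⟩
    refine ⟨?_, _, rfl⟩
    change parityHom k 1 0 (r (doubling k j.toAdd)) = 1
    rw [parityHom_r, parity_doubling, mul_zero, ofAdd_zero]
  · rintro ⟨h, i, rfl⟩
    have h' : 1 * parity k i.toAdd = 0 := h
    obtain ⟨j, hj⟩ := parity_eq_zero_iff.mp ((one_mul _).symm.trans h')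
    exact ⟨Multiplicative.ofAdd j, congrArg r hj⟩

end DihedralGroup

theorem numChains_comap_fst {D G E : Type*} [Group D] [Group G] [Group E] {f : G →* D}
    (hf : Function.Injective f) {K : Subgroup D} (hK : f.range = K) :
    numChains (K.comap (MonoidHom.fst D E)) = numChains (G × E) := by
  refine numChains_eq_of_range_eq (f := f.prodMap (MonoidHom.id E))
    (Prod.map_injective.mpr ⟨hf, Function.injective_id⟩) ?_
  subst hK
  ext ⟨x, y⟩
  simp [MonoidHom.mem_range, Prod.ext_iff, -MonoidHom.range_prodMap]

theorem numChains_multiplicative_prod_comm (A B : Type*) [AddGroup A] [AddGroup B] :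
    numChains (Multiplicative A × Multiplicative B) = numChains (Multiplicative (B × A)) :=
  numChains_congr (MulEquiv.prodComm.trans (MulEquiv.prodMultiplicative B A).symm)

open DihedralGroup in
theorem numChains_dihedralGroup_two_mul_prod {k n : ℕ} (hk : 2 * k = 2 ^ n) :
    (numChains (DihedralGroup (2 * k) × Multiplicative (ZMod 2)) : ℤ) =
      2 * numChains (Multiplicative (ZMod 2 × ZMod (2 * k)))
        + 8 * numChains (DihedralGroup (2 * k))
        - 16 * numChains (DihedralGroup k)
        - 4 * numChains (Multiplicative (ZMod 2 × ZMod k))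
        + 4 * numChains (DihedralGroup k × Multiplicative (ZMod 2)) := by
  have : NeZero (2 * k) := ⟨by rw [hk]; positivity⟩
  have hD : IsPGroup 2 (DihedralGroup (2 * k)) :=
    IsPGroup.of_card (n := n + 1) (by rw [nat_card, hk, pow_succ, mul_comm])
  have hab : parityHom k 1 0 * parityHom k 0 1 = parityHom k 1 1 := by simp [parityHom_mul]
  have h00 : parityHom k 0 0 = 1 := by
    rw [← mul_self_eq_one_of_zmod_two (parityHom k 0 0), parityHom_mul, add_zero]
  have h2 : ∀ y : ZMod 2, y = 0 ∨ y = 1 := by decide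
  have hrec := numChains_prod_zmod_two hD (a := parityHom k 1 0) (b := parityHom k 0 1)
    ⟨parityHom_ne_one (by simp), parityHom_ne_one (by simp),
      hab ▸ parityHom_ne_one (by simp)⟩ (fun χ => by
      obtain ⟨x, y, rfl⟩ := exists_eq_parityHom χ
      rw [hab]
      rcases h2 x with rfl | rfl <;> rcases h2 y with rfl | rfl <;> simp [h00])
  have ha : (double k 0).range = (parityHom k 1 0).ker := by rw [range_double, map_zero]
  have hc : (double k 1).range = (parityHom k 1 1).ker := by rw [range_double, map_one]
  have hinj : Function.Injective ((rotationHom (2 * k)).comp (doubling k).toMultiplicative) :=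
    (rotationHom_injective _).comp doubling_injective
  rw [hab, numChains_comap_fst (double_injective 0) ha, numChains_comap_fst (double_injective 1) hc,
    numChains_comap_fst (rotationHom_injective _) range_rotationHom,
    numChains_comap_fst hinj range_rotationHom_comp_doubling,
    numChains_eq_of_range_eq (double_injective 0) ha,
    numChains_eq_of_range_eq (double_injective 1) hc,
    numChains_eq_of_range_eq (rotationHom_injective _) range_rotationHom,
    numChains_eq_of_range_eq hinj range_rotationHom_comp_doubling,
    numChains_multiplicative_prod_comm, numChains_multiplicative_prod_comm,
    numChains_multiplicative_zmod_two_mul hk] at hrec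
  rw [hrec]
  push_cast
  ring

theorem numChains_dihedral_mul_C2_recurrence (n : ℕ) (hn : 3 < n) :
    (numChains (DihedralGroup (2 ^ (n - 1)) × Multiplicative (ZMod 2)) : ℤ) =
      2 * numChains (Multiplicative (ZMod 2 × ZMod (2 ^ (n - 1))))
        + 8 * numChains (DihedralGroup (2 ^ (n - 1)))
        - 16 * numChains (DihedralGroup (2 ^ (n - 2)))
        - 4 * numChains (Multiplicative (ZMod 2 × ZMod (2 ^ (n - 2))))
        + 4 * numChains (DihedralGroup (2 ^ (n - 2)) × Multiplicative (ZMod 2)) := by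
  have hpow : 2 ^ (n - 1) = 2 * 2 ^ (n - 2) := by
    rw [← pow_succ']
    congr 1
    omega
  rw [hpow]
  exact numChains_dihedralGroup_two_mul_prod hpow.symm
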